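/- Let L be a field of characteristic zero, let f, g ∈ L[t] with deg f ≤ 4 and deg g ≤ 6, and let a, b, t₀ ∈ L with t₀ ≠ 0, a·t₀+b ≠ 0, and 3·f(t₀) + (a·t₀+b)⁴ ≠ 0. Assume P(t₀) = 0 and P′(t₀) = 0. Then there exist c₀, d₀, e₀ ∈ L such that for every h ∈ L, setting c := c₀ − h/t₀³, d := d₀ + 3·h/t₀², and e := e₀ − 3·h/t₀, the polynomial H and all of its first and second formal partial derivatives vanish at the point (x₀, t₀) with x₀ := (a·t₀+b)²/3. In other words, the trisections of Lemma 3.3 can be chosen so that their coefficients depend affinely on the parameter h, the h-dependent part of the defining polynomial being h·(1 − t/t₀)³. -/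

import Mathlib

/-- The polynomial `H(x,t) = x³ + f(t)·x + g(t) − (a·x·t + b·x + c·t³ + d·t² + e·t + h)²`
as a multivariate polynomial over `L` in the two variables `X 0 = x` and `X 1 = t`. -/
noncomputable def Hpoly {L : Type*} [Field L] (a b c d e h : L) (f g : Polynomial L) :
    MvPolynomial (Fin 2) L :=
  (MvPolynomial.X 0) ^ 3
    + Polynomial.aeval (MvPolynomial.X 1) f * MvPolynomial.X 0
    + Polynomial.aeval (MvPolynomial.X 1) g
    - (MvPolynomial.C a * MvPolynomial.X 0 * MvPolynomial.X 1
        + MvPolynomial.C b * MvPolynomial.X 0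
        + MvPolynomial.C c * MvPolynomial.X 1 ^ 3
        + MvPolynomial.C d * MvPolynomial.X 1 ^ 2
        + MvPolynomial.C e * MvPolynomial.X 1
        + MvPolynomial.C h) ^ 2

/-- The polynomial `P(t) = −f(t)²/4 + (a·t+b)⁴·f(t)/6 + (a·t+b)²·g(t) + (a·t+b)⁸/108`. -/
noncomputable def Ppoly {L : Type*} [Field L] (a b : L) (f g : Polynomial L) : Polynomial L :=
  -(Polynomial.C (1 / 4 : L)) * f ^ 2
    + Polynomial.C (1 / 6 : L) * (Polynomial.C a * Polynomial.X + Polynomial.C b) ^ 4 * f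
    + (Polynomial.C a * Polynomial.X + Polynomial.C b) ^ 2 * g
    + Polynomial.C (1 / 108 : L) * (Polynomial.C a * Polynomial.X + Polynomial.C b) ^ 8

/-- Evaluating a univariate polynomial in one variable `X i` at `v` evaluates it at `v i`. -/
theorem MvPolynomial.eval_aeval_X {R σ : Type*} [CommSemiring R] (v : σ → R) (i : σ)
    (p : Polynomial R) :
    MvPolynomial.eval v (Polynomial.aeval (MvPolynomial.X i) p) = p.eval (v i) := by
  induction p using Polynomial.induction_on' with
  | add p q hp hq => simp [hp, hq]
  | monomial n r => simp [Polynomial.aeval_monomial, MvPolynomial.algebraMap_eq]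

/-- Over a field with `t ≠ 0`, a cubic with zero constant term and prescribed value, first and
second derivative at `t` exists. -/
theorem exists_cubic_jet {L : Type*} [Field L] [CharZero L] {t : L} (ht : t ≠ 0) (u v w : L) :
    ∃ c d e : L, c * t ^ 3 + d * t ^ 2 + e * t = u ∧ 3 * c * t ^ 2 + 2 * d * t + e = v ∧
      6 * c * t + 2 * d = w := by
  obtain ⟨c, hc⟩ : ∃ c : L, c * t ^ 3 = u - v * t + w * t ^ 2 / 2 :=
    ⟨(u - v * t + w * t ^ 2 / 2) / t ^ 3, by field_simp⟩
  refine ⟨c, w / 2 - 3 * c * t, v - w * t + 3 * c * t ^ 2, ?_, by ring, by ring⟩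
  linear_combination hc

/-- The pencil of trisections of Lemma 3.3 can be chosen with coefficients depending
affinely on the parameter `h`: there are `c₀, d₀, e₀` such that for every `h`, taking
`c = c₀ − h/t₀³`, `d = d₀ + 3h/t₀²`, `e = e₀ − 3h/t₀`, the polynomial `H` and all of its
first and second formal partial derivatives vanish at `(x₀, t₀)` with `x₀ = (at₀+b)²/3`;
the `h`-dependent part of the defining polynomial is `h·(1 − t/t₀)³`. -/
theorem stmt_5 {L : Type*} [Field L] [CharZero L] (f g : Polynomial L)
    (hf : f.degree ≤ 4) (hg : g.degree ≤ 6)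
    (a b t₀ : L) (ht₀ : t₀ ≠ 0) (hab : a * t₀ + b ≠ 0)
    (hfab : 3 * f.eval t₀ + (a * t₀ + b) ^ 4 ≠ 0)
    (hP : (Ppoly a b f g).eval t₀ = 0)
    (hP' : (Ppoly a b f g).derivative.eval t₀ = 0) :
    ∃ c₀ d₀ e₀ : L, ∀ h : L,
      MvPolynomial.eval ![(a * t₀ + b) ^ 2 / 3, t₀]
        (Hpoly a b (c₀ - h / t₀ ^ 3) (d₀ + 3 * h / t₀ ^ 2) (e₀ - 3 * h / t₀) h f g) = 0 ∧
      MvPolynomial.eval ![(a * t₀ + b) ^ 2 / 3, t₀]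
        (MvPolynomial.pderiv 0
          (Hpoly a b (c₀ - h / t₀ ^ 3) (d₀ + 3 * h / t₀ ^ 2) (e₀ - 3 * h / t₀) h f g)) = 0 ∧
      MvPolynomial.eval ![(a * t₀ + b) ^ 2 / 3, t₀]
        (MvPolynomial.pderiv 1
          (Hpoly a b (c₀ - h / t₀ ^ 3) (d₀ + 3 * h / t₀ ^ 2) (e₀ - 3 * h / t₀) h f g)) = 0 ∧
      MvPolynomial.eval ![(a * t₀ + b) ^ 2 / 3, t₀]
        (MvPolynomial.pderiv 0 (MvPolynomial.pderiv 0
          (Hpoly a b (c₀ - h / t₀ ^ 3) (d₀ + 3 * h / t₀ ^ 2) (e₀ - 3 * h / t₀) h f g))) = 0 ∧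
      MvPolynomial.eval ![(a * t₀ + b) ^ 2 / 3, t₀]
        (MvPolynomial.pderiv 1 (MvPolynomial.pderiv 0
          (Hpoly a b (c₀ - h / t₀ ^ 3) (d₀ + 3 * h / t₀ ^ 2) (e₀ - 3 * h / t₀) h f g))) = 0 ∧
      MvPolynomial.eval ![(a * t₀ + b) ^ 2 / 3, t₀]
        (MvPolynomial.pderiv 1 (MvPolynomial.pderiv 1
          (Hpoly a b (c₀ - h / t₀ ^ 3) (d₀ + 3 * h / t₀ ^ 2) (e₀ - 3 * h / t₀) h f g))) = 0 := by
  simp only [Ppoly, Polynomial.derivative_add, Polynomial.derivative_mul, Polynomial.derivative_neg,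
    Polynomial.derivative_pow, Polynomial.derivative_C, Polynomial.derivative_X,
    Polynomial.eval_add, Polynomial.eval_mul, Polynomial.eval_neg, Polynomial.eval_pow,
    Polynomial.eval_C, Polynomial.eval_X, Polynomial.eval_zero, Polynomial.eval_one] at hP hP'
  norm_num at hP hP'
  obtain ⟨m, hm⟩ : ∃ m, m = a * t₀ + b := ⟨_, rfl⟩
  obtain ⟨y, hy⟩ : ∃ y, 6 * m * y = 3 * f.eval t₀ + m ^ 4 :=
    ⟨(3 * f.eval t₀ + m ^ 4) / (6 * m), by rw [← hm] at hab; field_simp⟩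
  obtain ⟨r, hr⟩ : ∃ r, 2 * m * r = f.derivative.eval t₀ - 2 * a * y :=
    ⟨(f.derivative.eval t₀ - 2 * a * y) / (2 * m), by rw [← hm] at hab; field_simp⟩
  rw [← hm] at hab hfab hP hP' ⊢
  have hy0 : y ≠ 0 := by
    rintro rfl
    exact hfab (by linear_combination -hy)
  obtain ⟨s, hs⟩ : ∃ s, 2 * y * s = f.derivative.derivative.eval t₀ * (m ^ 2 / 3)
      + g.derivative.derivative.eval t₀ - 2 * r ^ 2 :=
    ⟨(f.derivative.derivative.eval t₀ * (m ^ 2 / 3)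
      + g.derivative.derivative.eval t₀ - 2 * r ^ 2) / (2 * y), by field_simp⟩
  obtain ⟨c, d, e, h0, h1, h2⟩ :=
    exists_cubic_jet ht₀ (y - m * (m ^ 2 / 3)) (r - a * (m ^ 2 / 3)) s
  refine ⟨c, d, e, fun h => ?_⟩
  obtain ⟨c', hc'⟩ : ∃ c', c' = c - h / t₀ ^ 3 := ⟨_, rfl⟩
  obtain ⟨d', hd'⟩ : ∃ d', d' = d + 3 * h / t₀ ^ 2 := ⟨_, rfl⟩
  obtain ⟨e', he'⟩ : ∃ e', e' = e - 3 * h / t₀ := ⟨_, rfl⟩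
  have k0 : a * (m ^ 2 / 3) * t₀ + b * (m ^ 2 / 3) + c' * t₀ ^ 3 + d' * t₀ ^ 2 + e' * t₀ + h
      = y := by
    rw [hc', hd', he']
    field_simp
    linear_combination 3 * h0 - m ^ 2 * hm
  have k1 : a * (m ^ 2 / 3) + c' * (3 * t₀ ^ 2) + d' * (2 * t₀) + e' = r := by
    rw [hc', hd', he']
    field_simp
    linear_combination 3 * t₀ * h1
  have k2 : 6 * c' * t₀ + 2 * d' = s := by
    rw [hc', hd']
    field_simp
    linear_combination t₀ ^ 2 * h2
  rw [← hc', ← hd', ← he']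
  have hF : f.eval t₀ = 2 * m * y - m ^ 4 / 3 := by linear_combination -hy / 3
  have hF' : f.derivative.eval t₀ = 2 * m * r + 2 * a * y := by linear_combination -hr
  have hG : g.eval t₀ = y ^ 2 - (m ^ 2 / 3) ^ 3 - f.eval t₀ * (m ^ 2 / 3) := by
    rw [hF] at hP ⊢
    apply mul_left_cancel₀ (pow_ne_zero 2 hab)
    linear_combination hP
  have hG' : g.derivative.eval t₀ = 2 * y * r - m ^ 2 / 3 * f.derivative.eval t₀ := by
    rw [hG, hF', hF] at hP'
    rw [hF']
    apply mul_left_cancel₀ (pow_ne_zero 2 hab)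
    linear_combination hP'
  have hm' : t₀ * a + b = m := by rw [hm, mul_comm]
  have h_two (i : Fin 2) : MvPolynomial.pderiv i (2 : MvPolynomial (Fin 2) L) = 0 :=
    (MvPolynomial.pderiv i).map_natCast 2
  have h_three (i : Fin 2) : MvPolynomial.pderiv i (3 : MvPolynomial (Fin 2) L) = 0 :=
    (MvPolynomial.pderiv i).map_natCast 3
  simp [Hpoly, Derivation.map_aeval, MvPolynomial.eval_aeval_X, MvPolynomial.pderiv_X,
    Derivation.leibniz, Derivation.leibniz_pow, h_two, h_three]
  rw [k0, k1, hm']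
  refine ⟨?_, ?_, ?_, ?_, ?_, ?_⟩
  · linear_combination hG
  · linear_combination hF
  · linear_combination hG'
  · ring
  · linear_combination hF'
  · linear_combination -hs - 2 * y * k2
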